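/- Suppose f_c has a Siegel disk Δ of period m ≥ 1 with center ζ. Then for every s > 0 there exist c̃ ∈ ℂ with |c̃ − c| < s and ζ̃ ∈ ℂ with |ζ̃ − ζ| < s such that ζ̃ is a parabolic periodic point of f_{c̃} of period m, i.e. f_{c̃}^[m](ζ̃) = ζ̃ and deriv (f_{c̃}^[m]) ζ̃ is a root of unity. In particular the orbit of 0 under f_{c̃} is bounded (so that J_{c̃} is connected) and B(ζ, s) ∩ J_{c̃} ≠ ∅. -/

import Mathlib

open Filter Metric Topology

noncomputable section

/-- The quadratic polynomial `f_c(z) = z² + c`. -/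
def f (c : ℂ) : ℂ → ℂ := fun z => z ^ 2 + c

/-- The filled Julia set `K_c`: points with bounded forward orbit. -/
def K (c : ℂ) : Set ℂ := {z : ℂ | Bornology.IsBounded (Set.range fun n => (f c)^[n] z)}

/-- The Julia set `J_c`: the boundary of the filled Julia set. -/
def J (c : ℂ) : Set ℂ := frontier (K c)

/-- A complex number is a root of unity. -/
def IsRootOfUnity (u : ℂ) : Prop := ∃ n : ℕ, 1 ≤ n ∧ u ^ n = 1

/-- `Δ` is a Siegel disk of `f_c` of period `m ≥ 1` with center `ζ`: an open connected
invariant set containing the fixed point `ζ` of `f_c^[m]`, on which `f_c^[m]` is conformally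
conjugate to an irrational rotation of the unit disk. -/
def IsSiegelDisk (c : ℂ) (m : ℕ) (Δ : Set ℂ) (ζ : ℂ) : Prop :=
  1 ≤ m ∧ IsOpen Δ ∧ IsConnected Δ ∧ ζ ∈ Δ ∧ (f c)^[m] '' Δ = Δ ∧ (f c)^[m] ζ = ζ ∧
    ∃ α : ℝ, Irrational α ∧ ∃ φ : ℂ → ℂ,
      DifferentiableOn ℂ φ Δ ∧ Set.BijOn φ Δ (Metric.ball (0 : ℂ) 1) ∧ φ ζ = 0 ∧
      ∀ w ∈ Δ, φ ((f c)^[m] w) = Complex.exp (2 * Real.pi * Complex.I * α) * φ w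

lemma f_apply (c z : ℂ) : f c z = z ^ 2 + c := rfl

lemma differentiable_f (c : ℂ) : Differentiable ℂ (f c) := by
  unfold f; fun_prop

lemma differentiable_f_iterate (c : ℂ) (n : ℕ) : Differentiable ℂ (f c)^[n] :=
  (differentiable_f c).iterate n

lemma norm_add_two_le_norm_f {c z : ℂ} (hz : ‖c‖ + 2 ≤ ‖z‖) : ‖z‖ + 2 ≤ ‖f c z‖ := by
  have h1 : ‖z ^ 2‖ - ‖c‖ ≤ ‖f c z‖ := by
    have := norm_sub_norm_le (z ^ 2) (-c)
    simpa [f_apply] using this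
  rw [norm_pow] at h1
  nlinarith [norm_nonneg c]

lemma norm_add_le_norm_f_iterate {c z : ℂ} (hz : ‖c‖ + 2 ≤ ‖z‖) (n : ℕ) :
    ‖z‖ + 2 * n ≤ ‖(f c)^[n] z‖ := by
  induction n with
  | zero => simp
  | succ n ih =>
    rw [Function.iterate_succ_apply']
    have : (0 : ℝ) ≤ n := n.cast_nonneg
    have := norm_add_two_le_norm_f (c := c) (z := (f c)^[n] z) (by linarith)
    push_cast
    linarith

lemma lt_norm_f_iterate_of_le {c z : ℂ} {r : ℝ} (hr : ‖c‖ + 2 ≤ r) {n k : ℕ} (hnk : n ≤ k)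
    (hz : r < ‖(f c)^[n] z‖) : r < ‖(f c)^[k] z‖ := by
  obtain ⟨j, rfl⟩ := Nat.exists_eq_add_of_le' hnk
  rw [Function.iterate_add_apply]
  have := norm_add_le_norm_f_iterate (hr.trans hz.le) j
  have : (0 : ℝ) ≤ j := j.cast_nonneg
  linarith

lemma tendsto_norm_f_iterate {c z : ℂ} {n : ℕ} (hz : ‖c‖ + 2 < ‖(f c)^[n] z‖) :
    Tendsto (fun k => ‖(f c)^[k] z‖) atTop atTop := by
  rw [← tendsto_add_atTop_iff_nat n]
  refine tendsto_atTop_mono (f := fun k : ℕ => (k : ℝ)) (fun k => ?_) tendsto_natCast_atTop_atTop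
  simp only [Function.iterate_add_apply]
  have := norm_add_le_norm_f_iterate hz.le k
  have : (0 : ℝ) ≤ k := k.cast_nonneg
  have := norm_nonneg ((f c)^[n] z)
  linarith

lemma mem_K_iff {c z : ℂ} : z ∈ K c ↔ ∀ n, ‖(f c)^[n] z‖ ≤ ‖c‖ + 2 := by
  rw [K, Set.mem_ofPred_eq, isBounded_iff_forall_norm_le]
  constructor
  · rintro ⟨C, hC⟩ n
    by_contra! h
    obtain ⟨k, hk⟩ := ((tendsto_norm_f_iterate h).eventually_gt_atTop C).exists
    exact absurd (hC _ ⟨k, rfl⟩) (not_le.2 hk)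
  · intro h
    exact ⟨_, by rintro _ ⟨n, rfl⟩; exact h n⟩

lemma K_eq_iInter (c : ℂ) : K c = ⋂ n, (f c)^[n] ⁻¹' closedBall 0 (‖c‖ + 2) := by
  ext z; simp [mem_K_iff]

lemma isClosed_K (c : ℂ) : IsClosed (K c) := by
  rw [K_eq_iInter]
  exact isClosed_iInter fun n => isClosed_closedBall.preimage
    (differentiable_f_iterate c n).continuous

lemma periodic_mem_K {c z : ℂ} {m : ℕ} (hm : 1 ≤ m) (hz : (f c)^[m] z = z) : z ∈ K c := by
  rw [mem_K_iff]
  by_contra! h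
  obtain ⟨n, hn⟩ := h
  have hlt : ‖z‖ < ‖z‖ := by
    have h1 := (tendsto_norm_f_iterate hn).comp
      (tendsto_id.const_mul_atTop' (r := m) (by omega))
    obtain ⟨k, hk⟩ := (h1.eventually_gt_atTop ‖z‖).exists
    have : (f c)^[m * k] z = z := by
      rw [Function.iterate_mul]
      exact Function.iterate_fixed hz k
    simp [this] at hk
  exact lt_irrefl _ hlt

lemma isOpenMap_f (c : ℂ) : IsOpenMap (f c) := by
  have h := (differentiable_f c).differentiableOn.analyticOnNhd (s := Set.univ) isOpen_univ
  rcases h.is_constant_or_isOpen isPreconnected_univ with ⟨w, hw⟩ | h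
  · have h0 := hw 0 trivial
    have h1 := hw 1 trivial
    rw [← h0] at h1
    simp [f_apply] at h1
  · exact fun s hs => h s (Set.subset_univ _) hs

lemma isClosedMap_f (c : ℂ) : IsClosedMap (f c) := by
  refine (isProperMap_iff_tendsto_cocompact.2 ⟨(differentiable_f c).continuous, ?_⟩).isClosedMap
  rw [← Metric.cobounded_eq_cocompact, tendsto_norm_atTop_iff_cobounded.symm]
  refine tendsto_atTop_mono' _ ?_ tendsto_norm_cobounded_atTop
  filter_upwards [tendsto_norm_cobounded_atTop.eventually_ge_atTop (‖c‖ + 2)] with z hz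
  linarith [norm_add_two_le_norm_f hz]

/-- The preimage of a connected set under `f c` is connected as soon as this holds for one
nonempty subset. -/
lemma IsPreconnected.preimage_f {c : ℂ} {S T : Set ℂ} (hS : IsPreconnected S) (hTS : T ⊆ S)
    (hTne : T.Nonempty) (hT : IsPreconnected (f c ⁻¹' T)) : IsPreconnected (f c ⁻¹' S) := by
  rw [isPreconnected_iff_preconnectedSpace,
    preconnectedSpace_iff_clopen]
  have : PreconnectedSpace S := isPreconnected_iff_preconnectedSpace.1 hS
  set g := S.restrictPreimage (f c) with hg
  have himage : ∀ A : Set (f c ⁻¹' S), IsClopen A → A = ∅ ∨ g '' A = Set.univ := by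
    intro A hA
    have : IsClopen (g '' A) := ⟨(isClosedMap_f c).restrictPreimage S _ hA.1,
      (isOpenMap_f c).restrictPreimage S _ hA.2⟩
    simpa using isClopen_iff.1 this
  have hT' : IsPreconnected ((↑) ⁻¹' (f c ⁻¹' T) : Set (f c ⁻¹' S)) := by
    rw [← Topology.IsInducing.subtypeVal.isPreconnected_image, Subtype.image_preimage_coe,
      Set.inter_eq_right.2 (Set.preimage_mono hTS)]
    exact hT
  intro A hA
  rcases himage A hA with h | h
  · exact Or.inl h
  rcases himage Aᶜ hA.compl with h' | h'
  · exact Or.inr (Set.compl_empty_iff.1 h')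
  exfalso
  obtain ⟨t, ht⟩ := hTne
  obtain ⟨x, hxA, hx⟩ : (⟨t, hTS ht⟩ : S) ∈ g '' A := h ▸ trivial
  obtain ⟨y, hyA, hy⟩ : (⟨t, hTS ht⟩ : S) ∈ g '' Aᶜ := h' ▸ trivial
  have hx' : f c x = t := congrArg Subtype.val hx
  have hy' : f c y = t := congrArg Subtype.val hy
  have hsub := hT'.subset_isClopen hA ⟨x, by simpa [hx'] using ht, hxA⟩
  exact hyA (hsub (by simpa [hy'] using ht))

/-- The intersection of a directed family of compact connected sets is connected. -/
lemma isPreconnected_iInter_of_directed {X ι : Type*} [TopologicalSpace X] [T2Space X]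
    [NormalSpace X] [Nonempty ι] {V : ι → Set X} (hV : Directed (· ⊇ ·) V)
    (hc : ∀ i, IsCompact (V i)) (hp : ∀ i, IsPreconnected (V i)) :
    IsPreconnected (⋂ i, V i) := by
  rw [isPreconnected_iff_subset_of_fully_disjoint_closed
    (isClosed_iInter fun i => (hc i).isClosed)]
  intro u v hu hv huv hd
  obtain ⟨U, W, hU, hW, huU, hvW, hUW⟩ := normal_separation hu hv hd
  obtain ⟨i, hi⟩ := exists_subset_nhds_of_isCompact' hV hc (fun i => (hc i).isClosed)
    (U := U ∪ W) fun x hx => (hU.union hW).mem_nhds (Set.union_subset_union huU hvW (huv hx))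
  rcases isPreconnected_iff_subset_of_disjoint.1 (hp i) U W hU hW hi
    (by simp [hUW.inter_eq]) with h | h
  · refine Or.inl fun x hx => (huv hx).resolve_right fun hxv => ?_
    exact hUW.ne_of_mem (h (Set.mem_iInter.1 hx i)) (hvW hxv) rfl
  · refine Or.inr fun x hx => (huv hx).resolve_left fun hxu => ?_
    exact hUW.ne_of_mem (huU hxu) (h (Set.mem_iInter.1 hx i)) rfl

lemma isPreconnected_K {c : ℂ} (h0 : (0 : ℂ) ∈ K c) : IsPreconnected (K c) := by
  have hsub : ∀ n k, n ≤ k → (f c)^[k] ⁻¹' closedBall 0 (‖c‖ + 2) ⊆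
      (f c)^[n] ⁻¹' closedBall 0 (‖c‖ + 2) := by
    intro n k hnk z hz
    simp only [Set.mem_preimage, mem_closedBall_zero_iff] at hz ⊢
    by_contra! h
    exact absurd (lt_norm_f_iterate_of_le le_rfl hnk h) (not_lt.2 hz)
  rw [K_eq_iInter]
  refine isPreconnected_iInter_of_directed
    (directed_of_isDirected_le fun n k hnk => hsub n k hnk) (fun n => ?_) (fun n => ?_)
  · refine (isCompact_closedBall 0 (‖c‖ + 2)).of_isClosed_subset
      (isClosed_closedBall.preimage (differentiable_f_iterate c n).continuous) ?_
    simpa using hsub 0 n n.zero_le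
  · induction n with
    | zero => simpa using (convex_closedBall (0 : ℂ) _).isPreconnected
    | succ n ih =>
      rw [Function.iterate_succ, Set.preimage_comp]
      refine ih.preimage_f (T := {c}) ?_ (Set.singleton_nonempty c) ?_
      · have := mem_K_iff.1 h0 (n + 1)
        rw [Function.iterate_succ_apply] at this
        simpa [f_apply] using this
      · have : f c ⁻¹' {c} = {0} := by ext z; simp [f_apply]
        rw [this]
        exact isPreconnected_singleton

lemma isPreconnected_setOf_lt_norm {r : ℝ} (hr : 0 < r) : IsPreconnected {z : ℂ | r < ‖z‖} := by
  have h : {z : ℂ | r < ‖z‖} = Complex.exp '' {w | Real.log r < w.re} := by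
    ext z
    simp only [Set.mem_ofPred_eq, Set.mem_image]
    constructor
    · intro hz
      have h0 : z ≠ 0 := norm_pos_iff.1 (hr.trans hz)
      exact ⟨Complex.log z, by rw [Complex.log_re]; exact Real.log_lt_log hr hz,
        Complex.exp_log h0⟩
    · rintro ⟨w, hw, rfl⟩
      rw [Complex.norm_exp]
      exact (Real.log_lt_iff_lt_exp hr).1 hw
  rw [h]
  exact (convex_halfSpace_re_gt _).isPreconnected.image _ Complex.continuous_exp.continuousOn

lemma isPreconnected_compl_K (c : ℂ) : IsPreconnected (K c)ᶜ := by
  have hpos : 0 < ‖c‖ + 2 := by positivity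
  have h : (K c)ᶜ = ⋃ n, (f c)^[n] ⁻¹' {z | ‖c‖ + 2 < ‖z‖} := by
    ext z; simp [mem_K_iff]
  have hsub : ∀ n, {z | ‖c‖ + 2 < ‖z‖} ⊆ (f c)^[n] ⁻¹' {z | ‖c‖ + 2 < ‖z‖} := fun n z hz =>
    lt_norm_f_iterate_of_le le_rfl n.zero_le (by simpa using hz)
  rw [h]
  refine isPreconnected_iUnion ⟨((‖c‖ + 3 : ℝ) : ℂ), Set.mem_iInter.2 fun n => hsub n ?_⟩
    fun n => ?_
  · rw [Set.mem_ofPred_eq, Complex.norm_real, Real.norm_of_nonneg (by positivity)]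
    linarith
  · induction n with
    | zero => simpa using isPreconnected_setOf_lt_norm hpos
    | succ n ih =>
      rw [Function.iterate_succ, Set.preimage_comp]
      have hpre : f c ⁻¹' {w | ‖w - c‖ = (2 * ‖c‖ + 3) ^ 2} = sphere 0 (2 * ‖c‖ + 3) := by
        ext z
        simp only [f_apply, Set.mem_preimage, Set.mem_ofPred_eq, add_sub_cancel_right, norm_pow,
          mem_sphere_zero_iff_norm]
        exact pow_left_inj₀ (norm_nonneg _) (by positivity) two_ne_zero
      refine ih.preimage_f (T := {w | ‖w - c‖ = (2 * ‖c‖ + 3) ^ 2}) ?_ ?_ ?_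
      · refine Set.Subset.trans (fun w hw => ?_) (hsub n)
        have h1 : ‖w - c‖ ≤ ‖w‖ + ‖c‖ := norm_sub_le _ _
        rw [Set.mem_ofPred_eq] at hw ⊢
        nlinarith [norm_nonneg c]
      · refine ⟨c + (((2 * ‖c‖ + 3) ^ 2 : ℝ) : ℂ), ?_⟩
        rw [Set.mem_ofPred_eq, add_sub_cancel_left, Complex.norm_real,
          Real.norm_of_nonneg (by positivity)]
      · rw [hpre]
        exact isPreconnected_sphere (by simp [Complex.rank_real_complex]) _ _

lemma IsPreconnected.eq_of_exp_eq_one {S : Set ℂ} (hS : IsPreconnected S) {h : ℂ → ℂ}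
    (hc : ContinuousOn h S) (he : ∀ z ∈ S, Complex.exp (h z) = 1) {x y : ℂ} (hx : x ∈ S)
    (hy : y ∈ S) : h x = h y := by
  have key : ∀ z ∈ S, ∃ n : ℤ, h z = n * (2 * Real.pi * Complex.I) := fun z hz =>
    Complex.exp_eq_one_iff.1 (he z hz)
  have hcont : ContinuousOn (fun z => (h z / (2 * Real.pi * Complex.I)).re) S :=
    Complex.continuous_re.comp_continuousOn (hc.div_const _)
  have hne : (2 * Real.pi * Complex.I : ℂ) ≠ 0 := Complex.two_pi_I_ne_zero
  have hmaps : Set.MapsTo (fun z => (h z / (2 * Real.pi * Complex.I)).re) S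
      (Set.range ((↑) : ℤ → ℝ)) := by
    intro z hz
    obtain ⟨n, hn⟩ := key z hz
    refine ⟨n, ?_⟩
    simp only [hn]
    rw [mul_div_cancel_right₀ _ hne, Complex.intCast_re]
  obtain ⟨w, -, hw⟩ := hS.eqOn_const_of_mapsTo
    (Int.isClosedEmbedding_coe_real.isEmbedding.isDiscrete_range) hcont hmaps
    (Set.range_nonempty _)
  obtain ⟨n, hn⟩ := key x hx
  obtain ⟨k, hk⟩ := key y hy
  have h1 := hw hx
  have h2 := hw hy
  simp only [hn, hk, mul_div_cancel_right₀ _ hne, Complex.intCast_re, Function.const_apply]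
    at h1 h2
  have : n = k := by exact_mod_cast h1.trans h2.symm
  rw [hn, hk, this]

/-- The plane is unicoherent. -/
lemma isPreconnected_inter_of_union_eq_univ {A B : Set ℂ} (hA : IsClosed A) (hB : IsClosed B)
    (hAc : IsPreconnected A) (hBc : IsPreconnected B) (hAB : A ∪ B = Set.univ) :
    IsPreconnected (A ∩ B) := by
  classical
  rw [isPreconnected_iff_subset_of_fully_disjoint_closed (hA.inter hB)]
  intro P Q hP hQ hPQ hd
  by_contra! hcon
  obtain ⟨hnP, hnQ⟩ := hcon
  obtain ⟨q, hq, hqP⟩ := Set.not_subset.1 hnP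
  obtain ⟨p, hp, hpQ⟩ := Set.not_subset.1 hnQ
  replace hqP := (hPQ hq).resolve_left hqP
  replace hpQ := (hPQ hp).resolve_right hpQ
  obtain ⟨u, hu0, hu1, -⟩ := exists_continuous_zero_one_of_isClosed hP hQ hd
  have hu : Continuous u := u.continuous
  let e : ℂ → ℂ := fun z => Real.pi * Complex.I * u z
  have he : Continuous e := by fun_prop
  have hF : Continuous fun z => if z ∈ A then Complex.exp (e z) else Complex.exp (-e z) := by
    refine continuous_if ?_ (by fun_prop) (by fun_prop)
    intro z hz
    have hzA : z ∈ A := hA.frontier_subset hz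
    have hzB : z ∈ B := by
      rw [frontier_eq_closure_inter_closure] at hz
      refine hB.closure_subset_iff.2 (fun w hw => ?_) hz.2
      exact ((Set.eq_univ_iff_forall.1 hAB) w).resolve_left hw
    rcases hPQ ⟨hzA, hzB⟩ with h | h
    · simp [e, hu0 h]
    · simp [e, hu1 h, Complex.exp_neg, Complex.exp_pi_mul_I]
  have hsc : IsSimplyConnected (Set.univ : Set ℂ) := by
    have : ContractibleSpace (Set.univ : Set ℂ) :=
      convex_univ.contractibleSpace Set.univ_nonempty
    exact SimplyConnectedSpace.ofContractible _
  obtain ⟨θ, hθ, hexp⟩ := Complex.exists_continuousOn_eqOn_exp_comp (X := ℂ) (U := Set.univ)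
    hsc isOpen_univ
    hF.continuousOn (by
      rintro ⟨z, -, hz⟩
      dsimp only at hz
      split_ifs at hz <;> exact Complex.exp_ne_zero _ hz)
  have hθ' : Continuous θ := continuousOn_univ.1 hθ
  have hA1 : ∀ z ∈ A, Complex.exp (θ z - e z) = 1 := by
    intro z hz
    have := hexp (Set.mem_univ z)
    simp only [Function.comp_apply, hz, if_true] at this
    rw [Complex.exp_sub, this, div_self (Complex.exp_ne_zero _)]
  have hB1 : ∀ z ∈ B, Complex.exp (θ z + e z) = 1 := by
    intro z hz
    have := hexp (Set.mem_univ z)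
    simp only [Function.comp_apply] at this
    by_cases hzA : z ∈ A
    · rw [if_pos hzA] at this
      rw [Complex.exp_add, this]
      rcases hPQ ⟨hzA, hz⟩ with h | h
      · simp [e, hu0 h]
      · simp [e, hu1 h, Complex.exp_pi_mul_I]
    · rw [if_neg hzA] at this
      rw [Complex.exp_add, this, ← Complex.exp_add]
      simp
  have h1 := hAc.eq_of_exp_eq_one (by fun_prop) hA1 hp.1 hq.1
  have h2 := hBc.eq_of_exp_eq_one (by fun_prop) hB1 hp.2 hq.2
  have hp0 : u p = 0 := hu0 hpQ
  have hq1 : u q = 1 := hu1 hqP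
  simp only [e, hp0, hq1, Complex.ofReal_zero, Complex.ofReal_one, mul_zero, mul_one, sub_zero,
    add_zero] at h1 h2
  have h3 : (2 * Real.pi * Complex.I : ℂ) = 0 := by linear_combination h1 - h2
  exact Complex.two_pi_I_ne_zero h3

lemma isConnected_J {c : ℂ} (h0 : (0 : ℂ) ∈ K c) : IsConnected (J c) := by
  have hJ : J c = K c ∩ closure (K c)ᶜ := by
    rw [J, frontier_eq_closure_inter_closure, (isClosed_K c).closure_eq]
  refine ⟨nonempty_frontier_iff.2 ⟨⟨0, h0⟩, fun h => ?_⟩, ?_⟩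
  · have h1 : ((‖c‖ + 3 : ℝ) : ℂ) ∈ K c := h ▸ Set.mem_univ _
    have h2 := mem_K_iff.1 h1 0
    rw [Function.iterate_zero_apply, Complex.norm_real, Real.norm_of_nonneg (by positivity)] at h2
    linarith
  · rw [hJ]
    refine isPreconnected_inter_of_union_eq_univ (isClosed_K c) isClosed_closure
      (isPreconnected_K h0) (isPreconnected_compl_K c).closure ?_
    exact Set.eq_univ_of_univ_subset ((Set.union_compl_self (K c)).symm.subset.trans
      (Set.union_subset_union_right _ subset_closure))

lemma norm_le_div_of_eventuallyEq_pow_mul {v : ℂ → ℂ} {z₀ : ℂ} {r : ℝ} (hr : 0 < r)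
    (hv : ContinuousAt v z₀) (p : ℕ) : ∀ {H : ℂ → ℂ} {M : ℝ}, DifferentiableOn ℂ H (ball z₀ r) →
    (∀ z ∈ ball z₀ r, ‖H z‖ ≤ M) → (H =ᶠ[𝓝 z₀] fun z => (z - z₀) ^ p * v z) →
    ‖v z₀‖ ≤ M / r ^ p := by
  induction p with
  | zero =>
    intro H M _ hM h
    have h0 := h.eq_of_nhds
    simp only [pow_zero, one_mul] at h0
    simpa [← h0] using hM z₀ (mem_ball_self hr)
  | succ p ih =>
    intro H M hd hM h
    have h0 : H z₀ = 0 := by simpa using h.eq_of_nhds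
    have hd' := (Complex.differentiableOn_dslope (ball_mem_nhds z₀ hr)).2 hd
    have hM' : ∀ z ∈ ball z₀ r, ‖dslope H z₀ z‖ ≤ M / r := fun z hz =>
      Complex.norm_dslope_le_div_of_mapsTo_ball hd
        (fun w hw => by simpa [h0] using hM w hw) hz
    have hc : ContinuousAt (dslope H z₀) z₀ :=
      (hd'.differentiableAt (ball_mem_nhds z₀ hr)).continuousAt
    have h' : dslope H z₀ =ᶠ[𝓝 z₀] fun z => (z - z₀) ^ p * v z := by
      refine (hc.eventuallyEq_nhds_iff_eventuallyEq_nhdsNE (by fun_prop)).1 ?_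
      filter_upwards [h.filter_mono nhdsWithin_le_nhds, self_mem_nhdsWithin] with z hz hne
      have hne' : z - z₀ ≠ 0 := sub_ne_zero.2 hne
      rw [dslope_of_ne _ hne, slope_def_field, hz, h0]
      field_simp
      ring
    have := ih hd' hM' h'
    rwa [div_div, ← pow_succ'] at this

lemma exists_eventually_iterate_eq_add_pow_mul {G u : ℂ → ℂ} {z₀ : ℂ} {p : ℕ} (hp : 2 ≤ p)
    (hG : ContinuousAt G z₀) (hfix : G z₀ = z₀) (hu : ContinuousAt u z₀)
    (h : ∀ᶠ z in 𝓝 z₀, G z = z + (z - z₀) ^ p * u z) (k : ℕ) :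
    ∃ v : ℂ → ℂ, ContinuousAt v z₀ ∧ v z₀ = k * u z₀ ∧
      ∀ᶠ z in 𝓝 z₀, G^[k] z = z + (z - z₀) ^ p * v z := by
  induction k with
  | zero => exact ⟨fun _ => 0, continuousAt_const, by simp, by simp⟩
  | succ k ih =>
    obtain ⟨v, hv, hv0, hvk⟩ := ih
    have hGk : ContinuousAt G^[k] z₀ := hG.iterate hfix k
    have hfixk : G^[k] z₀ = z₀ := Function.iterate_fixed hfix k
    refine ⟨fun z => v z + (1 + (z - z₀) ^ (p - 1) * v z) ^ p * u (G^[k] z), ?_, ?_, ?_⟩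
    · have : ContinuousAt (fun z => u (G^[k] z)) z₀ :=
        ContinuousAt.comp (g := u) (by rwa [hfixk]) hGk
      have h1 : ContinuousAt (fun z => (1 + (z - z₀) ^ (p - 1) * v z) ^ p) z₀ := by fun_prop
      exact hv.add (h1.mul this)
    · simp only [sub_self, hfixk, hv0]
      rw [zero_pow (by omega)]
      push_cast
      ring
    · have htend : Tendsto G^[k] (𝓝 z₀) (𝓝 z₀) := by simpa [ContinuousAt, hfixk] using hGk
      filter_upwards [hvk, htend.eventually h] with z hz hz'
      rw [Function.iterate_succ_apply', hz']
      have hsub : G^[k] z - z₀ = (z - z₀) * (1 + (z - z₀) ^ (p - 1) * v z) := by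
        obtain ⟨n, rfl⟩ : ∃ n, p = n + 1 := ⟨p - 1, by omega⟩
        rw [hz, Nat.add_sub_cancel]
        ring
      rw [hsub, mul_pow]
      nth_rewrite 1 [hz]
      ring

/-- The iterates of a holomorphic germ tangent to the identity are not normal at the fixed
point, unless the germ is the identity. -/
lemma eventually_eq_self_of_bounded_iterates {G : ℂ → ℂ} {z₀ : ℂ} {r M : ℝ}
    (hG : AnalyticAt ℂ G z₀) (hfix : G z₀ = z₀) (hderiv : deriv G z₀ = 1) (hr : 0 < r)
    (H : ℕ → ℂ → ℂ) (hd : ∀ k, DifferentiableOn ℂ (H k) (ball z₀ r))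
    (hM : ∀ k, ∀ z ∈ ball z₀ r, ‖H k z‖ ≤ M) (hH : ∀ k, H k =ᶠ[𝓝 z₀] G^[k]) :
    ∀ᶠ z in 𝓝 z₀, G z = z := by
  have hh : AnalyticAt ℂ (fun z => G z - z) z₀ := hG.sub analyticAt_id
  by_contra hne
  have hfin : analyticOrderAt (fun z => G z - z) z₀ ≠ ⊤ := by
    rw [Ne, analyticOrderAt_eq_top]
    simpa only [sub_eq_zero] using hne
  obtain ⟨p, hp⟩ := ENat.ne_top_iff_exists.1 hfin
  obtain ⟨u, hu, hu0, h⟩ := (hh.analyticOrderAt_eq_natCast).1 hp.symm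
  simp only [smul_eq_mul] at h
  have hp2 : 2 ≤ p := by
    by_contra! hlt
    interval_cases p
    · have := h.self_of_nhds
      simp [hfix] at this
      exact hu0 this.symm
    · have h1 : HasDerivAt (fun z => (z - z₀) ^ 1 * u z) (u z₀) z₀ := by
        simpa using (((hasDerivAt_id' z₀).sub_const z₀).fun_pow 1).fun_mul
          hu.differentiableAt.hasDerivAt
      have h2 : HasDerivAt (fun z => G z - z) (1 - 1) z₀ := by
        simpa [hderiv] using hG.differentiableAt.hasDerivAt.fun_sub (hasDerivAt_id' z₀)
      have := (h1.congr_of_eventuallyEq h).unique h2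
      exact hu0 (by simpa using this)
  have hbound : ∀ k : ℕ, k * ‖u z₀‖ ≤ (M + (‖z₀‖ + r)) / r ^ p := by
    intro k
    obtain ⟨v, hv, hv0, hvk⟩ := exists_eventually_iterate_eq_add_pow_mul hp2 hG.continuousAt hfix
      hu.continuousAt (h.mono fun z hz => by rw [← hz]; ring) k
    have := norm_le_div_of_eventuallyEq_pow_mul hr hv p (H := fun z => H k z - z)
      (M := M + (‖z₀‖ + r)) ((hd k).sub differentiableOn_id) (fun z hz => ?_) ?_
    · simpa [hv0] using this
    · refine (norm_sub_le _ _).trans (add_le_add (hM k z hz) ?_)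
      have h1 : ‖z - z₀‖ < r := by simpa [dist_eq_norm] using hz
      have h2 := norm_add_le z₀ (z - z₀)
      rw [add_sub_cancel] at h2
      linarith
    · filter_upwards [hH k, hvk] with z hz hz'
      rw [hz, hz']
      ring
  obtain ⟨k, hk⟩ := exists_nat_gt ((M + (‖z₀‖ + r)) / r ^ p / ‖u z₀‖)
  rw [div_lt_iff₀ (norm_pos_iff.2 hu0)] at hk
  exact absurd (hbound k) (not_le.2 hk)

lemma lt_norm_f_iterate_self {c z : ℂ} (hz : ‖c‖ + 2 ≤ ‖z‖) {n : ℕ} (hn : 1 ≤ n) :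
    ‖z‖ < ‖(f c)^[n] z‖ := by
  have := norm_add_le_norm_f_iterate hz n
  have : (1 : ℝ) ≤ n := by exact_mod_cast hn
  linarith

lemma not_eventually_f_iterate_eq_self (c ζ : ℂ) {n : ℕ} (hn : 1 ≤ n) :
    ¬ ∀ᶠ z in 𝓝 ζ, (f c)^[n] z = z := by
  intro h
  have h1 : AnalyticOnNhd ℂ (f c)^[n] Set.univ :=
    (differentiable_f_iterate c n).differentiableOn.analyticOnNhd isOpen_univ
  have h2 := h1.eq_of_eventuallyEq analyticOnNhd_id h
  have h3 : ‖((‖c‖ + 2 : ℝ) : ℂ)‖ = ‖c‖ + 2 := by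
    rw [Complex.norm_real, Real.norm_of_nonneg (by positivity)]
  have := lt_norm_f_iterate_self h3.ge hn
  rw [h2] at this
  exact lt_irrefl _ this

lemma mem_J_of_deriv_eq_one {c ζ : ℂ} {n : ℕ} (hn : 1 ≤ n) (hfix : (f c)^[n] ζ = ζ)
    (hd : deriv (f c)^[n] ζ = 1) : ζ ∈ J c := by
  refine ⟨subset_closure (periodic_mem_K hn hfix), fun hint => ?_⟩
  obtain ⟨r, hr, hball⟩ := Metric.isOpen_iff.1 isOpen_interior ζ hint
  refine not_eventually_f_iterate_eq_self c ζ hn ?_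
  refine eventually_eq_self_of_bounded_iterates (M := ‖c‖ + 2)
    ((differentiable_f_iterate c n).analyticAt ζ) hfix hd hr (fun k => ((f c)^[n])^[k])
    (fun k => ((differentiable_f_iterate c n).iterate k).differentiableOn) (fun k z hz => ?_)
    (fun k => EventuallyEq.rfl)
  rw [← Function.iterate_mul]
  exact mem_K_iff.1 (interior_subset (hball hz)) _

lemma exists_differentiableOn_sq_eq {g : ℂ → ℂ} {a y : ℂ} {r : ℝ} (hr : 0 < r)
    (hg : DifferentiableOn ℂ g (ball a r)) (h0 : ∀ z ∈ ball a r, g z ≠ 0) (hy : y ^ 2 = g a) :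
    ∃ s : ℂ → ℂ, DifferentiableOn ℂ s (ball a r) ∧ s a = y ∧ ∀ z ∈ ball a r, s z ^ 2 = g z := by
  have hsc : IsSimplyConnected (ball a r) := by
    have : ContractibleSpace (ball a r) :=
      (convex_ball a r).contractibleSpace (nonempty_ball.2 hr)
    exact SimplyConnectedSpace.ofContractible _
  obtain ⟨s, hs, hsq⟩ := Complex.exists_continuousOn_pow_eq hsc isOpen_ball hg.continuousOn
    (by rintro ⟨z, hz, hz0⟩; exact h0 z hz hz0) two_ne_zero
  have hd : DifferentiableOn ℂ s (ball a r) := by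
    intro w hw
    have hnhds := isOpen_ball.mem_nhds hw
    have hsw : ContinuousAt s w := hs.continuousAt hnhds
    have hsum : s w + s w ≠ 0 := by
      rw [← two_mul]
      refine mul_ne_zero two_ne_zero fun h => h0 w hw ?_
      rw [← hsq, h, zero_pow two_ne_zero]
    have hgw := (hg.differentiableAt hnhds).hasDerivAt
    refine DifferentiableAt.differentiableWithinAt (HasDerivAt.differentiableAt
      (f' := deriv g w * (s w + s w)⁻¹) ?_)
    rw [hasDerivAt_iff_tendsto_slope] at hgw ⊢
    have hlim : Tendsto (fun z => (s z + s w)⁻¹) (𝓝[≠] w) (𝓝 (s w + s w)⁻¹) :=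
      ((hsw.add continuousAt_const).inv₀ hsum).tendsto.mono_left nhdsWithin_le_nhds
    refine (hgw.mul hlim).congr' ?_
    have hev : ∀ᶠ z in 𝓝 w, s z + s w ≠ 0 :=
      (hsw.add continuousAt_const).eventually_ne hsum
    filter_upwards [hev.filter_mono nhdsWithin_le_nhds] with z hz
    simp only [slope_def_field, ← hsq]
    rw [sq_sub_sq]
    field_simp
  rcases sq_eq_sq_iff_eq_or_eq_neg.1 ((hsq a).trans hy.symm) with h | h
  · exact ⟨s, hd, h, fun z _ => hsq z⟩
  · exact ⟨fun z => -s z, hd.neg, by simp [h], fun z _ => by rw [neg_sq, hsq]⟩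

lemma exists_inverse_branch {c ζ : ℂ} {r : ℝ} (hr : 0 < r)
    (hcrit : ∀ j, (f c)^[j] 0 ∉ ball ζ r) {x : ℕ → ℂ} (hx0 : x 0 = ζ)
    (hx : ∀ k, f c (x (k + 1)) = x k) (k : ℕ) :
    ∃ h : ℂ → ℂ, DifferentiableOn ℂ h (ball ζ r) ∧ h ζ = x k ∧
      ∀ w ∈ ball ζ r, (f c)^[k] (h w) = w := by
  induction k with
  | zero => exact ⟨id, differentiableOn_id, hx0.symm, fun w _ => rfl⟩
  | succ k ih =>
    obtain ⟨h, hd, hζ, hinv⟩ := ih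
    obtain ⟨s, hsd, hsζ, hsq⟩ := exists_differentiableOn_sq_eq (y := x (k + 1)) hr
      (hd.sub_const c) (fun w hw h0 => hcrit (k + 1) (by
        have hw' := hinv w hw
        rw [sub_eq_zero.1 h0] at hw'
        rw [Function.iterate_succ_apply, f_apply, zero_pow two_ne_zero, zero_add, hw']
        exact hw)) (by simp only [hζ, ← hx k, f_apply, add_sub_cancel_right])
    refine ⟨s, hsd, hsζ, fun w hw => ?_⟩
    rw [Function.iterate_succ_apply, f_apply, hsq w hw, sub_add_cancel, hinv w hw]

lemma exists_ball_forall_f_iterate_zero_notMem {c ζ : ℂ} (hζ : ζ ∈ K c) (h0 : (0 : ℂ) ∉ K c) :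
    ∃ r > 0, ∀ j, (f c)^[j] 0 ∉ ball ζ r := by
  obtain ⟨N, hN⟩ := not_forall.1 (mt mem_K_iff.2 h0)
  have hev := (tendsto_norm_f_iterate (not_le.1 hN)).eventually_gt_atTop (‖ζ‖ + 1)
  obtain ⟨L, hL⟩ := eventually_atTop.1 hev
  have hne : ∀ j, (f c)^[j] 0 ≠ ζ := by
    intro j hj
    refine h0 (mem_K_iff.2 fun n => ?_)
    by_contra! hn
    have := lt_norm_f_iterate_of_le le_rfl (Nat.le_add_right n j) hn
    rw [Function.iterate_add_apply, hj] at this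
    exact absurd (mem_K_iff.1 hζ n) (not_le.2 this)
  have hfin : ((fun j => (f c)^[j] 0) '' Set.Iio L).Finite := (Set.finite_Iio L).image _
  obtain ⟨r, hr, hball⟩ := Metric.isOpen_iff.1 hfin.isClosed.isOpen_compl ζ (by
    rintro ⟨j, -, hj⟩
    exact hne j hj)
  refine ⟨min r 1, lt_min hr one_pos, fun j hj => ?_⟩
  rcases lt_or_ge j L with hjL | hjL
  · exact hball (ball_subset_ball (min_le_left _ _) hj) ⟨j, hjL, rfl⟩
  · have h1 := ball_subset_ball (min_le_right r 1) hj
    rw [mem_ball, dist_eq_norm] at h1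
    have h2 := norm_add_le ζ ((f c)^[j] 0 - ζ)
    rw [add_sub_cancel] at h2
    linarith [hL j hjL]

lemma zero_mem_K_of_deriv_eq_one {c ζ : ℂ} {n : ℕ} (hn : 1 ≤ n) (hfix : (f c)^[n] ζ = ζ)
    (hd : deriv (f c)^[n] ζ = 1) : (0 : ℂ) ∈ K c := by
  by_contra h0
  obtain ⟨r, hr, hcrit⟩ :=
    exists_ball_forall_f_iterate_zero_notMem (periodic_mem_K hn hfix) h0
  have hfixmul : ∀ j, (f c)^[n * j] ζ = ζ := fun j => by
    rw [Function.iterate_mul]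
    exact Function.iterate_fixed hfix j
  choose h hdiff hζ hinv using exists_inverse_branch (c := c) (ζ := ζ) hr hcrit
    (x := fun k => (f c)^[k * (n - 1)] ζ) (by simp) (fun k => by
      obtain ⟨l, rfl⟩ : ∃ l, n = l + 1 := ⟨n - 1, by omega⟩
      rw [← Function.iterate_succ_apply' (f c),
        show ((k + 1) * (l + 1 - 1)).succ = k * (l + 1 - 1) + (l + 1) by
          simp only [Nat.add_sub_cancel, Nat.succ_eq_add_one]; ring,
        Function.iterate_add_apply, hfix])
  have hmulζ : ∀ j, h (n * j) ζ = ζ := fun j => by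
    rw [hζ, mul_assoc, hfixmul]
  have hnζ : h n ζ = ζ := by simpa using hmulζ 1
  have hball : ball ζ r ∈ 𝓝 ζ := ball_mem_nhds ζ hr
  have hcont : ∀ k, ContinuousAt (h k) ζ := fun k =>
    ((hdiff k).differentiableAt hball).continuousAt
  have hg : Differentiable ℂ (f c)^[n] := differentiable_f_iterate c n
  have hgderiv : HasDerivAt (f c)^[n] 1 ζ := hd ▸ (hg ζ).hasDerivAt
  have hGderiv : deriv (h n) ζ = 1 := by
    have h1 : HasDerivAt (fun w => (f c)^[n] (h n w)) (1 * deriv (h n) ζ) ζ :=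
      HasDerivAt.comp ζ (h₂ := (f c)^[n]) (by rwa [hnζ])
        ((hdiff n).differentiableAt hball).hasDerivAt
    have h2 : (fun w => (f c)^[n] (h n w)) =ᶠ[𝓝 ζ] fun w => w := by
      filter_upwards [hball] with w hw using hinv n w hw
    simpa using (h1.congr_of_eventuallyEq h2.symm).unique (hasDerivAt_id' ζ)
  have hiter : ∀ j, ContinuousAt (h n)^[j] ζ := fun j => (hcont n).iterate hnζ j
  have hiterζ : ∀ j, (h n)^[j] ζ = ζ := fun j => Function.iterate_fixed hnζ j
  have hiterinv : ∀ j, ∀ᶠ w in 𝓝 ζ, ((f c)^[n])^[j] ((h n)^[j] w) = w := by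
    intro j
    induction j with
    | zero => simp
    | succ j ih =>
      have hmem : ∀ᶠ w in 𝓝 ζ, (h n)^[j] w ∈ ball ζ r :=
        (hiter j).eventually_mem (by rwa [hiterζ])
      filter_upwards [ih, hmem] with w hw hw'
      rw [Function.iterate_succ_apply, Function.iterate_succ_apply', hinv n _ hw', hw]
  have heq : ∀ j, h (n * j) =ᶠ[𝓝 ζ] (h n)^[j] := by
    intro j
    have hj : HasStrictDerivAt (((f c)^[n])^[j]) 1 ζ := by
      have h1 := HasDerivAt.iterate ζ hgderiv hfix j
      rw [one_pow] at h1
      have h2 := ((hg.iterate j).analyticAt ζ).hasStrictDerivAt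
      rwa [h1.deriv] at h2
    obtain ⟨L, hL⟩ : ∃ L : ℂ → ℂ, ∀ᶠ w in 𝓝 ζ, L (((f c)^[n])^[j] w) = w :=
      ⟨_, (hj.hasStrictFDerivAt_equiv one_ne_zero).eventually_left_inverse⟩
    have h1 := (show Tendsto (h (n * j)) (𝓝 ζ) (𝓝 ζ) by
      simpa only [ContinuousAt, hmulζ] using hcont (n * j)).eventually hL
    have h2 := (show Tendsto (h n)^[j] (𝓝 ζ) (𝓝 ζ) by
      simpa only [ContinuousAt, hiterζ] using hiter j).eventually hL
    filter_upwards [h1, h2, hiterinv j, hball] with w hw1 hw2 hw3 hw4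
    rw [← hw1, ← hw2, hw3, ← Function.iterate_mul, hinv _ w hw4]
  have hid := eventually_eq_self_of_bounded_iterates (M := ‖c‖ + 2 + ‖ζ‖ + r)
    ((hdiff n).analyticAt hball) hnζ hGderiv hr (fun j => h (n * j)) (fun j => hdiff _)
    (fun j w hw => by
      by_contra! hlt
      have hw' : ‖w‖ < ‖ζ‖ + r := by
        rw [mem_ball, dist_eq_norm] at hw
        have := norm_add_le ζ (w - ζ)
        rw [add_sub_cancel] at this
        linarith
      have h1 : ‖c‖ + 2 ≤ ‖h (n * j) w‖ := by linarith [norm_nonneg ζ]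
      have h2 := norm_add_le_norm_f_iterate h1 (n * j)
      rw [hinv _ w hw] at h2
      have : (0 : ℝ) ≤ (n * j : ℕ) := Nat.cast_nonneg _
      linarith [norm_nonneg c]) heq
  refine not_eventually_f_iterate_eq_self c ζ hn ?_
  filter_upwards [hid, hball] with w hw hw'
  conv_lhs => rw [← hw]
  exact hinv n w hw'

lemma IsSiegelDisk.norm_deriv_eq_one_and_ne {c ζ : ℂ} {m : ℕ} {Δ : Set ℂ}
    (h : IsSiegelDisk c m Δ ζ) :
    ‖deriv (f c)^[m] ζ‖ = 1 ∧ deriv (f c)^[m] ζ ≠ 1 := by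
  obtain ⟨-, hΔ, -, hζ, -, hfix, α, hα, φ, hφ, hbij, hφζ, hconj⟩ := h
  set μ := Complex.exp (2 * Real.pi * Complex.I * α) with hμ
  have hμ1 : μ ≠ 1 := by
    intro h1
    obtain ⟨n, hn⟩ := Complex.exp_eq_one_iff.1 h1
    rw [mul_comm] at hn
    have : (α : ℂ) = n := mul_right_cancel₀ Complex.two_pi_I_ne_zero hn
    exact hα ⟨n, by exact_mod_cast this.symm⟩
  have hμnorm : ‖μ‖ = 1 := by
    rw [hμ, Complex.norm_exp]
    simp
  have hnhds : Δ ∈ 𝓝 ζ := hΔ.mem_nhds hζ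
  have hφan : AnalyticAt ℂ φ ζ := hφ.analyticAt hnhds
  have hfin : analyticOrderAt φ ζ ≠ ⊤ := by
    rw [Ne, analyticOrderAt_eq_top]
    intro h0
    obtain ⟨w, ⟨hw, hwΔ⟩, hne⟩ := (((h0.and hnhds).filter_mono
      (nhdsWithin_le_nhds (s := {ζ}ᶜ))).and self_mem_nhdsWithin).exists
    exact hne (hbij.injOn hwΔ hζ (by rw [hw, hφζ]))
  obtain ⟨k, hk⟩ := ENat.ne_top_iff_exists.1 hfin
  obtain ⟨u, hu, hu0, hφu⟩ := (hφan.analyticOrderAt_eq_natCast).1 hk.symm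
  simp only [smul_eq_mul] at hφu
  have hF : Differentiable ℂ (f c)^[m] := differentiable_f_iterate c m
  have hFc : Tendsto (f c)^[m] (𝓝 ζ) (𝓝 ζ) := by
    simpa only [ContinuousAt, hfix] using hF.continuous.continuousAt (x := ζ)
  have hD : ContinuousAt (dslope (f c)^[m] ζ) ζ := continuousAt_dslope_same.2 (hF ζ)
  have huF : ContinuousAt (fun z => u ((f c)^[m] z)) ζ :=
    ContinuousAt.comp (g := u) (by rw [hfix]; exact hu.continuousAt) hF.continuous.continuousAt
  have key : (fun z => dslope (f c)^[m] ζ z ^ k * u ((f c)^[m] z)) =ᶠ[𝓝 ζ]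
      fun z => μ * u z := by
    refine ((hD.pow k).mul huF |>.eventuallyEq_nhds_iff_eventuallyEq_nhdsNE
      (continuousAt_const.mul hu.continuousAt)).1 ?_
    filter_upwards [(hφu.and ((hFc.eventually hφu).and hnhds)).filter_mono nhdsWithin_le_nhds,
      self_mem_nhdsWithin] with z ⟨h1, h2, h3⟩ hne
    have hne' : z - ζ ≠ 0 := sub_ne_zero.2 hne
    have h4 : (f c)^[m] z - ζ = (z - ζ) * dslope (f c)^[m] ζ z := by
      rw [← smul_eq_mul, sub_smul_dslope, hfix]
    have h5 := hconj z h3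
    rw [h1, h2, h4, mul_pow] at h5
    refine mul_left_cancel₀ (pow_ne_zero k hne') ?_
    change (z - ζ) ^ k * (dslope (f c)^[m] ζ z ^ k * u ((f c)^[m] z)) = (z - ζ) ^ k * (μ * u z)
    linear_combination h5
  have hpow : deriv (f c)^[m] ζ ^ k = μ := by
    have := key.eq_of_nhds
    rw [dslope_same, hfix] at this
    exact mul_right_cancel₀ hu0 this
  refine ⟨?_, fun h1 => hμ1 (by rw [← hpow, h1, one_pow])⟩
  have hk0 : k ≠ 0 := by
    rintro rfl
    exact hμ1 (by rw [← hpow, pow_zero])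
  refine (pow_eq_one_iff_of_nonneg (norm_nonneg _) hk0).1 ?_
  rw [← norm_pow, hpow, hμnorm]

lemma hasDerivAt_f_iterate (c z : ℂ) (n : ℕ) :
    HasDerivAt (f c)^[n] (∏ i ∈ Finset.range n, 2 * (f c)^[i] z) z := by
  induction n with
  | zero => simpa using hasDerivAt_id z
  | succ n ih =>
    have h1 : HasDerivAt (f c) (2 * (f c)^[n] z) ((f c)^[n] z) :=
      ((hasDerivAt_pow 2 ((f c)^[n] z)).add_const c).congr_deriv (by simp)
    rw [Finset.prod_range_succ, mul_comm, Function.iterate_succ']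
    exact h1.comp z ih

lemma AnalyticAt.f_iterate {E : Type*} [NormedAddCommGroup E] [NormedSpace ℂ E] {a b : E → ℂ}
    {x : E} (ha : AnalyticAt ℂ a x) (hb : AnalyticAt ℂ b x) (n : ℕ) :
    AnalyticAt ℂ (fun p => (f (a p))^[n] (b p)) x := by
  induction n with
  | zero => exact hb
  | succ n ih =>
    simp only [Function.iterate_succ_apply', f_apply]
    exact (ih.pow 2).add ha

lemma exists_analyticAt_periodic {c ζ : ℂ} {m : ℕ} (hfix : (f c)^[m] ζ = ζ)
    (hd : deriv (f c)^[m] ζ ≠ 1) :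
    ∃ ψ : ℂ → ℂ, AnalyticAt ℂ ψ c ∧ ψ c = ζ ∧ ∀ᶠ c' in 𝓝 c, (f c')^[m] (ψ c') = ψ c' := by
  let Φ : ℂ × ℂ → ℂ := fun p => (f p.1)^[m] p.2 - p.2
  have hΦ : AnalyticAt ℂ Φ (c, ζ) :=
    (analyticAt_fst.f_iterate analyticAt_snd m).sub analyticAt_snd
  have hcd : ContDiffAt ℂ ⊤ Φ (c, ζ) := hΦ.contDiffAt
  have hinv : (fderiv ℂ Φ (c, ζ) ∘L .inr ℂ ℂ ℂ).IsInvertible := by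
    have h1 : HasFDerivAt (fun z : ℂ => Φ (c, z)) (fderiv ℂ Φ (c, ζ) ∘L .inr ℂ ℂ ℂ) ζ :=
      HasFDerivAt.comp ζ hΦ.differentiableAt.hasFDerivAt (hasFDerivAt_prodMk_right c ζ)
    have h2 : HasDerivAt (fun z : ℂ => Φ (c, z)) (deriv (f c)^[m] ζ - 1) ζ :=
      ((differentiable_f_iterate c m) ζ).hasDerivAt.fun_sub (hasDerivAt_id' ζ)
    refine ⟨ContinuousLinearEquiv.unitsEquivAut ℂ (Units.mk0 _ (sub_ne_zero.2 hd)), ?_⟩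
    rw [h1.unique h2.hasFDerivAt]
    ext
    simp
  refine ⟨hcd.implicitFunction (by simp) hinv, ?_, hcd.implicitFunction_apply_self _ hinv, ?_⟩
  · exact (hcd.contDiffAt_implicitFunction (by simp) hinv).analyticAt
  · filter_upwards [hcd.eventually_apply_implicitFunction (by simp) hinv] with c' hc'
    have h0 : Φ (c, ζ) = 0 := sub_eq_zero.2 hfix
    rw [h0] at hc'
    exact sub_eq_zero.1 hc'

/-- The iterate `(f c)^[n] z` as a polynomial in `z` with coefficients polynomial in `c`. -/
def iteratePoly (n : ℕ) : Polynomial (Polynomial ℂ) :=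
  (fun p => p ^ 2 + Polynomial.C Polynomial.X)^[n] Polynomial.X

lemma eval_map_iteratePoly (c z : ℂ) (n : ℕ) :
    ((iteratePoly n).map (Polynomial.evalRingHom c)).eval z = (f c)^[n] z := by
  induction n with
  | zero => simp [iteratePoly]
  | succ n ih =>
    rw [iteratePoly, Function.iterate_succ_apply', Function.iterate_succ_apply', ← iteratePoly,
      f_apply, ← ih]
    simp

lemma eval_derivative_map_iteratePoly (c z : ℂ) (n : ℕ) :
    ((iteratePoly n).derivative.map (Polynomial.evalRingHom c)).eval z = deriv (f c)^[n] z := by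
  rw [← Polynomial.derivative_map, ← Polynomial.deriv]
  congr 1
  funext w
  exact eval_map_iteratePoly c w n

lemma monic_iteratePoly_and_natDegree (n : ℕ) :
    (iteratePoly n).Monic ∧ (iteratePoly n).natDegree = 2 ^ n := by
  induction n with
  | zero => exact ⟨Polynomial.monic_X, by simp [iteratePoly]⟩
  | succ n ih =>
    obtain ⟨hm, hdeg⟩ := ih
    have hdeg2 : (iteratePoly n ^ 2).natDegree = 2 ^ (n + 1) := by
      rw [hm.natDegree_pow, hdeg, pow_succ']
    rw [iteratePoly, Function.iterate_succ_apply', ← iteratePoly]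
    refine ⟨(hm.pow 2).add_of_left ?_, by rw [Polynomial.natDegree_add_C, hdeg2]⟩
    refine Polynomial.degree_C_le.trans_lt ?_
    rw [← Polynomial.natDegree_pos_iff_degree_pos, hdeg2]
    positivity

/-- A multiplier which is locally constant along a branch of periodic points is a multiplier
of `z ↦ z ^ 2`. -/
lemma multiplier_eq_of_eventually_const {c l : ℂ} {m : ℕ} (hm : 1 ≤ m) {ψ : ℂ → ℂ}
    (hψ : ∀ᶠ c' in 𝓝 c, (f c')^[m] (ψ c') = ψ c' ∧ deriv (f c')^[m] (ψ c') = l) :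
    ∃ z, (f 0)^[m] z = z ∧ deriv (f 0)^[m] z = l := by
  obtain ⟨hmonic, hdeg⟩ := monic_iteratePoly_and_natDegree m
  set P := iteratePoly m - Polynomial.X with hP
  set Q := (iteratePoly m).derivative - Polynomial.C (Polynomial.C l) with hQ
  have h2m : 1 < 2 ^ m := Nat.one_lt_two_pow (by omega)
  have hXlt : (Polynomial.X : Polynomial (Polynomial ℂ)).degree < (iteratePoly m).degree :=
    Polynomial.degree_lt_degree (by rw [hdeg, Polynomial.natDegree_X]; exact h2m)
  have hPmonic : P.Monic := hmonic.sub_of_left hXlt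
  have hPdeg : P.natDegree = 2 ^ m := by
    rw [hP, Polynomial.natDegree_sub_eq_left_of_natDegree_lt
      (by rw [hdeg, Polynomial.natDegree_X]; exact h2m), hdeg]
  have hPeval : ∀ c' z, (P.map (Polynomial.evalRingHom c')).eval z = (f c')^[m] z - z := by
    intro c' z
    rw [hP, Polynomial.map_sub, Polynomial.eval_sub, eval_map_iteratePoly, Polynomial.map_X,
      Polynomial.eval_X]
  have hQeval : ∀ c' z, (Q.map (Polynomial.evalRingHom c')).eval z =
      deriv (f c')^[m] z - l := by
    intro c' z
    rw [hQ, Polynomial.map_sub, Polynomial.eval_sub, eval_derivative_map_iteratePoly]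
    simp
  obtain ⟨A, B, -, -, hAB⟩ := Polynomial.exists_mul_add_mul_eq_C_resultant P Q le_rfl le_rfl
    (Or.inl (by rw [hPdeg]; positivity))
  have hres0 : P.resultant Q P.natDegree Q.natDegree = 0 := by
    refine Polynomial.eq_zero_of_infinite_isRoot _ ((infinite_of_mem_nhds c hψ).mono ?_)
    rintro c' ⟨h1, h2⟩
    have h3 := congrArg (fun R => (R.map (Polynomial.evalRingHom c')).eval (ψ c')) hAB
    simp only [Polynomial.map_add, Polynomial.map_mul, Polynomial.eval_add, Polynomial.eval_mul,
      hPeval, hQeval, h1, h2, sub_self, zero_mul, add_zero, Polynomial.map_C,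
      Polynomial.eval_C] at h3
    exact h3.symm
  have h0 := Polynomial.resultant_map_map P Q P.natDegree Q.natDegree (Polynomial.evalRingHom 0)
  rw [hres0, map_zero, ← hPmonic.natDegree_map (Polynomial.evalRingHom (0 : ℂ)),
    Polynomial.resultant_eq_prod_eval _ _ _ Polynomial.natDegree_map_le
      (IsAlgClosed.splits _), (hPmonic.map _).leadingCoeff, one_pow, one_mul,
    Multiset.prod_eq_zero_iff] at h0
  obtain ⟨z, hz, hz0⟩ := Multiset.mem_map.1 h0
  rw [Polynomial.mem_roots (hPmonic.map _).ne_zero, Polynomial.IsRoot, hPeval, sub_eq_zero] at hz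
  rw [hQeval, sub_eq_zero] at hz0
  exact ⟨z, hz, hz0⟩

lemma norm_deriv_f_zero_iterate_ne_one {m : ℕ} (hm : 1 ≤ m) {z : ℂ} (hz : (f 0)^[m] z = z) :
    ‖deriv (f 0)^[m] z‖ ≠ 1 := by
  have hit : ∀ n, (f 0)^[n] z = z ^ 2 ^ n := by
    intro n
    induction n with
    | zero => simp
    | succ n ih => rw [Function.iterate_succ_apply', ih, f_apply, add_zero, ← pow_mul, pow_succ]
  rw [(hasDerivAt_f_iterate 0 z m).deriv, norm_prod]
  rcases eq_or_ne z 0 with rfl | h0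
  · rw [Finset.prod_eq_zero (Finset.mem_range.2 (by omega : 0 < m)) (by simp)]
    exact zero_ne_one
  · have h1 : ‖z‖ = 1 := by
      have h2 : ‖z‖ ^ (2 ^ m - 1) * ‖z‖ = 1 * ‖z‖ := by
        rw [← pow_succ, Nat.sub_add_cancel Nat.one_le_two_pow, ← norm_pow, ← hit, hz, one_mul]
      have h2m : 1 < 2 ^ m := Nat.one_lt_two_pow (by omega)
      exact (pow_eq_one_iff_of_nonneg (norm_nonneg _) (by omega)).1
        (mul_right_cancel₀ (norm_ne_zero_iff.2 h0) h2)
    simp only [hit, norm_mul, norm_pow, h1, one_pow, mul_one, Complex.norm_two,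
      Finset.prod_const, Finset.card_range]
    exact (one_lt_pow₀ one_lt_two (by omega)).ne'

lemma frequently_isRootOfUnity {l : ℂ} (hl : ‖l‖ = 1) : ∃ᶠ w in 𝓝 l, IsRootOfUnity w := by
  let e : ℝ → ℂ := fun t => Complex.exp (2 * Real.pi * Complex.I * t)
  have he : Continuous e := by fun_prop
  obtain ⟨t, rfl⟩ : ∃ t, e t = l := by
    have h1 := Complex.norm_mul_exp_arg_mul_I l
    rw [hl, Complex.ofReal_one, one_mul] at h1
    refine ⟨Complex.arg l / (2 * Real.pi), Eq.trans ?_ h1⟩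
    have : (Real.pi : ℂ) ≠ 0 := by exact_mod_cast Real.pi_ne_zero
    simp only [e]
    congr 1
    push_cast
    field_simp
  have hfreq : ∃ᶠ s in 𝓝 t, s ∈ Set.range ((↑) : ℚ → ℝ) :=
    mem_closure_iff_frequently.1 (Rat.denseRange_cast t)
  refine (he.continuousAt (x := t)).tendsto.frequently (hfreq.mono ?_)
  rintro _ ⟨q, rfl⟩
  refine ⟨q.den, q.pos, ?_⟩
  rw [← Complex.exp_nat_mul, Complex.exp_eq_one_iff]
  refine ⟨q.num, ?_⟩
  have h1 : (q.den : ℂ) * q = q.num := by exact_mod_cast Rat.den_mul_eq_num q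
  rw [Complex.ofReal_ratCast]
  linear_combination (2 * Real.pi * Complex.I) * h1

/-- Perturbation of a Siegel disk into a parabolic point: if `f_c` has a Siegel disk of
period `m` centered at `ζ`, then arbitrarily small perturbations `c̃` of `c` have a
parabolic periodic point `ζ̃` of period `m` near `ζ`; moreover for such `c̃` the orbit of
`0` is bounded (so `J_{c̃}` is connected) and `B(ζ,s)` meets `J_{c̃}`. -/
theorem siegel_perturb_parabolic (c : ℂ) (m : ℕ) (Δ : Set ℂ) (ζ : ℂ)
    (hΔ : IsSiegelDisk c m Δ ζ) :
    ∀ s > (0 : ℝ), ∃ c' ζ' : ℂ, dist c' c < s ∧ dist ζ' ζ < s ∧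
      (f c')^[m] ζ' = ζ' ∧ IsRootOfUnity (deriv ((f c')^[m]) ζ') ∧
      Bornology.IsBounded (Set.range fun n => (f c')^[n] 0) ∧
      IsConnected (J c') ∧
      (Metric.ball ζ s ∩ J c').Nonempty := by
  intro s hs
  obtain ⟨hnorm, hne⟩ := hΔ.norm_deriv_eq_one_and_ne
  obtain ⟨hm, -, -, -, -, hfix, -⟩ := hΔ
  obtain ⟨ψ, hψ, hψc, hper⟩ := exists_analyticAt_periodic hfix hne
  let L : ℂ → ℂ := fun c' => deriv (f c')^[m] (ψ c')
  have hL : AnalyticAt ℂ L c := by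
    simp only [L, (hasDerivAt_f_iterate _ _ m).deriv]
    exact Finset.analyticAt_fun_prod _ fun i _ =>
      analyticAt_const.mul (analyticAt_id.f_iterate hψ i)
  have hLc : L c = deriv (f c)^[m] ζ := by simp only [L, hψc]
  have hmap : 𝓝 (L c) ≤ map L (𝓝 c) := by
    refine hL.eventually_constant_or_nhds_le_map_nhds.resolve_left fun hconst => ?_
    obtain ⟨z, hz, hdz⟩ := multiplier_eq_of_eventually_const hm (hper.and hconst)
    refine norm_deriv_f_zero_iterate_ne_one hm hz ?_
    rw [hdz, hLc, hnorm]
  have hfreq : ∃ᶠ c' in 𝓝 c, IsRootOfUnity (L c') :=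
    (frequently_isRootOfUnity (hLc ▸ hnorm)).filter_mono hmap
  have hball : ∀ᶠ c' in 𝓝 c, c' ∈ ball c s := ball_mem_nhds c hs
  obtain ⟨c', hroot, hper', hc', hψ'⟩ := (hfreq.and_eventually (hper.and
    (hball.and (hψ.continuousAt.eventually_mem
      (hψc.symm ▸ ball_mem_nhds ζ hs))))).exists
  rw [hψc] at hψ'
  obtain ⟨q, hq, hLq⟩ := id hroot
  have hmq : 1 ≤ m * q := Nat.mul_pos hm hq
  have hfix' : (f c')^[m * q] (ψ c') = ψ c' := by
    rw [Function.iterate_mul]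
    exact Function.iterate_fixed hper' q
  have hderiv' : deriv (f c')^[m * q] (ψ c') = 1 := by
    rw [Function.iterate_mul, ← hLq]
    exact (HasDerivAt.iterate _ ((differentiable_f_iterate c' m) _).hasDerivAt hper' q).deriv
  have h0 := zero_mem_K_of_deriv_eq_one hmq hfix' hderiv'
  exact ⟨c', ψ c', hc', hψ', hper', hroot, h0, isConnected_J h0, ψ c', hψ',
    mem_J_of_deriv_eq_one hmq hfix' hderiv'⟩
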